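/- arXiv:2405.14041 — 2 statements merged into one kernel-verified Lean document; each statement's English description precedes it below -/
import Mathlib

section
/- The pattern sets {123, 213} and {312, 321} are shape-Wilf-equivalent. -/
/-- A pattern is a permutation of `Fin k` for some `k : ℕ` (a permutation of length `k`,
written 0-indexed). -/
def Pattern : Type := Σ k : ℕ, Equiv.Perm (Fin k)

/-- Build a pattern from an explicit vector of values (0-indexed one-line notation). -/
noncomputable def mkPattern {k : ℕ} (v : Fin k → Fin k) (h : Function.Bijective v := by decide) : Pattern :=
  ⟨k, Equiv.ofBijective v h⟩

/-- The permutation `π` of length `n` contains an occurrence of the pattern `p`: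
there are indices `i₁ < ⋯ < i_k` (given by a strictly monotone `f`) such that
`π (f a) < π (f b) ↔ p a < p b` for all `a b`. -/
def PermContains {n : ℕ} (π : Equiv.Perm (Fin n)) (p : Pattern) : Prop :=
  ∃ f : Fin p.1 → Fin n, StrictMono f ∧
    ∀ a b : Fin p.1, π (f a) < π (f b) ↔ p.2 a < p.2 b

/-- `π` avoids every pattern in the set `S`. -/
def AvoidsSet {n : ℕ} (π : Equiv.Perm (Fin n)) (S : Set Pattern) : Prop :=
  ∀ p ∈ S, ¬ PermContains π p

/-- Two sets of patterns are Wilf-equivalent: for every `n ≥ 1`, the number of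
permutations of length `n` avoiding every pattern of `S1` equals the number of
permutations of length `n` avoiding every pattern of `S2`. -/
def WilfEquiv (S1 S2 : Set Pattern) : Prop :=
  ∀ n : ℕ, 1 ≤ n →
    Nat.card {π : Equiv.Perm (Fin n) // AvoidsSet π S1} =
    Nat.card {π : Equiv.Perm (Fin n) // AvoidsSet π S2}

/-- A Ferrers board on `[n] × [n]`: a downward-closed set of cells `(column, row)`
(0-indexed). -/
structure FerrersBoard (n : ℕ) where
  cells : Set (Fin n × Fin n)
  downward_closed : ∀ ⦃i j i' j' : Fin n⦄, (i, j) ∈ cells → i' ≤ i → j' ≤ j → (i', j') ∈ cells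

/-- `σ` is a filling of the Ferrers board `F`: each rook `(i, σ i)` lies on the board. -/
def IsFilling {n : ℕ} (F : FerrersBoard n) (σ : Equiv.Perm (Fin n)) : Prop :=
  ∀ i : Fin n, (i, σ i) ∈ F.cells

/-- The filling `σ` of `F` contains an occurrence of the pattern `p`: there are
columns `f 0 < f 1 < ⋯` whose rooks are order-isomorphic to `p`, and the whole
rectangle spanned by the occurrence lies in `F` (equivalently, by downward closure,
the top-right corner cell lies in `F`). -/
def FillingContains {n : ℕ} (F : FerrersBoard n) (σ : Equiv.Perm (Fin n)) (p : Pattern) : Prop :=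
  ∃ f : Fin p.1 → Fin n, StrictMono f ∧
    (∀ a b : Fin p.1, σ (f a) < σ (f b) ↔ p.2 a < p.2 b) ∧
    (∀ a b : Fin p.1, (f a, σ (f b)) ∈ F.cells)

/-- The filling `σ` of `F` avoids every pattern in the set `S`. -/
def FillingAvoidsSet {n : ℕ} (F : FerrersBoard n) (σ : Equiv.Perm (Fin n)) (S : Set Pattern) : Prop :=
  ∀ p ∈ S, ¬ FillingContains F σ p

/-- Two sets of patterns are shape-Wilf-equivalent: for every `n ≥ 1` and every
Ferrers board `F` on `[n] × [n]`, the number of fillings of `F` avoiding every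
pattern of `S1` equals the number of fillings of `F` avoiding every pattern of `S2`. -/
def ShapeWilfEquiv (S1 S2 : Set Pattern) : Prop :=
  ∀ n : ℕ, 1 ≤ n → ∀ F : FerrersBoard n,
    Nat.card {σ : Equiv.Perm (Fin n) // IsFilling F σ ∧ FillingAvoidsSet F σ S1} =
    Nat.card {σ : Equiv.Perm (Fin n) // IsFilling F σ ∧ FillingAvoidsSet F σ S2}

/-- Rooks on the board such that no rook has two rooks to its lower left. -/
def FillingAvoidsLowerLeftPair {n : ℕ} (F : FerrersBoard n) (σ : Equiv.Perm (Fin n)) : Prop :=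
  (∀ i, (i, σ i) ∈ F.cells) ∧ ∀ i j k, i < j → j < k → σ i < σ k → ¬ σ j < σ k

/-- Rooks on the board such that no rook has two rooks to its lower right within the columns
that meet its row. -/
def FillingAvoidsLowerRightPair {n : ℕ} (F : FerrersBoard n) (σ : Equiv.Perm (Fin n)) : Prop :=
  (∀ i, (i, σ i) ∈ F.cells) ∧
    ∀ i j k, i < j → j < k → σ j < σ i → σ k < σ i → (k, σ i) ∉ F.cells

theorem strictMono_vec_three {n : ℕ} {i j k : Fin n} (hij : i < j) (hjk : j < k) :
    StrictMono ![i, j, k] := by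
  intro a b hab
  have := hij.trans hjk
  fin_cases a <;> fin_cases b <;> simp_all

theorem fillingContains_mkPattern_iff {n k : ℕ} (F : FerrersBoard n) (σ : Equiv.Perm (Fin n))
    (v : Fin k → Fin k) (hv : Function.Bijective v) :
    FillingContains F σ (mkPattern v hv) ↔ ∃ f : Fin k → Fin n, StrictMono f ∧
      (∀ a b, σ (f a) < σ (f b) ↔ v a < v b) ∧ ∀ a b, (f a, σ (f b)) ∈ F.cells :=
  Iff.rfl

theorem filling_avoids_123_213_iff {n : ℕ} (F : FerrersBoard n) (σ : Equiv.Perm (Fin n)) :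
    (IsFilling F σ ∧ FillingAvoidsSet F σ {mkPattern ![0,1,2], mkPattern ![1,0,2]}) ↔
      FillingAvoidsLowerLeftPair F σ := by
  refine and_congr_right fun hF => ⟨fun h i j k hij hjk hik hjk' => ?_, ?_⟩
  · have cell : ∀ a b : Fin 3, (![i, j, k] a, σ (![i, j, k] b)) ∈ F.cells := fun a b =>
      F.downward_closed (hF k)
        (by fin_cases a <;> simp [hjk.le, (hij.trans hjk).le])
        (by fin_cases b <;> simp [hik.le, hjk'.le])
    rcases lt_or_gt_of_ne (σ.injective.ne hij.ne) with h' | h'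
    · refine h _ (Or.inl rfl) ((fillingContains_mkPattern_iff ..).2
        ⟨![i, j, k], strictMono_vec_three hij hjk, ?_, cell⟩)
      intro a b
      fin_cases a <;> fin_cases b <;> simp [*, le_of_lt]
    · refine h _ (Or.inr rfl) ((fillingContains_mkPattern_iff ..).2
        ⟨![i, j, k], strictMono_vec_three hij hjk, ?_, cell⟩)
      intro a b
      fin_cases a <;> fin_cases b <;> simp [*, le_of_lt]
  · rintro h p (rfl | rfl) hp
    all_goals
      obtain ⟨f, hf, ho, -⟩ := (fillingContains_mkPattern_iff ..).1 hp
      exact h (f 0) (f 1) (f 2) (hf (by decide : (0 : Fin 3) < 1))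
        (hf (by decide : (1 : Fin 3) < 2))
        ((ho 0 2).2 (by decide))
        ((ho 1 2).2 (by decide))

theorem filling_avoids_312_321_iff {n : ℕ} (F : FerrersBoard n) (σ : Equiv.Perm (Fin n)) :
    (IsFilling F σ ∧ FillingAvoidsSet F σ {mkPattern ![2,0,1], mkPattern ![2,1,0]}) ↔
      FillingAvoidsLowerRightPair F σ := by
  refine and_congr_right fun hF => ⟨fun h i j k hij hjk hji hki hc => ?_, ?_⟩
  · have cell : ∀ a b : Fin 3, (![i, j, k] a, σ (![i, j, k] b)) ∈ F.cells := fun a b =>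
      F.downward_closed hc
        (by fin_cases a <;> simp [hjk.le, (hij.trans hjk).le])
        (by fin_cases b <;> simp [hji.le, hki.le])
    rcases lt_or_gt_of_ne (σ.injective.ne hjk.ne) with h' | h'
    · refine h _ (Or.inl rfl) ((fillingContains_mkPattern_iff ..).2
        ⟨![i, j, k], strictMono_vec_three hij hjk, ?_, cell⟩)
      intro a b
      fin_cases a <;> fin_cases b <;> simp [*, le_of_lt]
    · refine h _ (Or.inr rfl) ((fillingContains_mkPattern_iff ..).2
        ⟨![i, j, k], strictMono_vec_three hij hjk, ?_, cell⟩)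
      intro a b
      fin_cases a <;> fin_cases b <;> simp [*, le_of_lt]
  · rintro h p (rfl | rfl) hp
    all_goals
      obtain ⟨f, hf, ho, hc⟩ := (fillingContains_mkPattern_iff ..).1 hp
      exact h (f 0) (f 1) (f 2) (hf (by decide : (0 : Fin 3) < 1))
        (hf (by decide : (1 : Fin 3) < 2))
        ((ho 1 0).2 (by decide))
        ((ho 2 0).2 (by decide))
        (hc 2 0)

/-- The permutation with maximum in position `c` and the other entries ordered as in `τ`. -/
def insertMax {n : ℕ} (c : Fin (n + 1)) (τ : Equiv.Perm (Fin n)) : Equiv.Perm (Fin (n + 1)) :=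
  (finSuccEquiv' c).trans (τ.optionCongr.trans (finSuccEquiv' (Fin.last n)).symm)

@[simp]
theorem insertMax_self {n : ℕ} (c : Fin (n + 1)) (τ : Equiv.Perm (Fin n)) :
    insertMax c τ c = Fin.last n := by
  simp [insertMax]

@[simp]
theorem insertMax_succAbove {n : ℕ} (c : Fin (n + 1)) (τ : Equiv.Perm (Fin n)) (i : Fin n) :
    insertMax c τ (c.succAbove i) = (τ i).castSucc := by
  simp [insertMax]

theorem bijective_insertMax (n : ℕ) :
    Function.Bijective fun p : Fin (n + 1) × Equiv.Perm (Fin n) => insertMax p.1 p.2 := by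
  rw [Fintype.bijective_iff_injective_and_card]
  constructor
  · rintro ⟨c, τ⟩ ⟨d, ρ⟩ (h : insertMax c τ = insertMax d ρ)
    obtain rfl : c = d := (insertMax d ρ).injective <| by
      rw [insertMax_self, ← h, insertMax_self]
    have : τ = ρ := Equiv.ext fun i => by
      simpa using DFunLike.congr_fun h (c.succAbove i)
    rw [this]
  · simp [Fintype.card_perm, Nat.factorial_succ]

namespace FerrersBoard

/-- Delete the top row and the first column. -/
def deleteCorner {n : ℕ} (F : FerrersBoard (n + 1)) : FerrersBoard n where
  cells := {p | (p.1.succ, p.2.castSucc) ∈ F.cells}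
  downward_closed _ _ _ _ h hi hj :=
    F.downward_closed h (Fin.succ_le_succ_iff.2 hi) (Fin.castSucc_le_castSucc_iff.2 hj)

theorem mem_deleteCorner_iff {n : ℕ} (F : FerrersBoard (n + 1)) {c : Fin (n + 1)}
    (hc : (c, Fin.last n) ∈ F.cells) (i j : Fin n) :
    (i, j) ∈ F.deleteCorner.cells ↔ (c.succAbove i, j.castSucc) ∈ F.cells := by
  change (i.succ, j.castSucc) ∈ F.cells ↔ _
  rcases lt_or_ge i.castSucc c with h | h
  · rw [Fin.succAbove_of_castSucc_lt _ _ h]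
    exact iff_of_true
      (F.downward_closed hc (Fin.castSucc_lt_iff_succ_le.1 h) (Fin.le_last _))
      (F.downward_closed hc h.le (Fin.le_last _))
  · rw [Fin.succAbove_of_le_castSucc _ _ h]

end FerrersBoard

theorem insertMax_avoidsLowerLeftPair_iff {n : ℕ} (F : FerrersBoard (n + 1)) (c : Fin (n + 1))
    (τ : Equiv.Perm (Fin n)) :
    FillingAvoidsLowerLeftPair F (insertMax c τ) ↔
      ((c, Fin.last n) ∈ F.cells ∧ c.val ≤ 1) ∧
        FillingAvoidsLowerLeftPair F.deleteCorner τ := by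
  constructor
  · rintro ⟨hF, h⟩
    have hc : (c, Fin.last n) ∈ F.cells := by simpa using hF c
    refine ⟨⟨hc, ?_⟩, fun i => ?_, fun i j k hij hjk hik hjk' => ?_⟩
    · by_contra! h1
      have lt_max : ∀ a, a ≠ c → insertMax c τ a < insertMax c τ c := fun a ha =>
        lt_of_le_of_ne (by simpa using Fin.le_last _) ((insertMax c τ).injective.ne ha)
      refine h ⟨0, by omega⟩ ⟨1, by omega⟩ c (by simp [Fin.lt_def]) (by simpa [Fin.lt_def])
        (lt_max _ ?_) (lt_max _ ?_) <;> simp only [ne_eq, Fin.ext_iff] <;> omega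
    · simpa [F.mem_deleteCorner_iff hc] using hF (c.succAbove i)
    · exact h (c.succAbove i) (c.succAbove j) (c.succAbove k) (Fin.strictMono_succAbove c hij)
        (Fin.strictMono_succAbove c hjk) (by simpa) (by simpa)
  · rintro ⟨⟨hc, h1⟩, hF, h⟩
    refine ⟨(Fin.forall_iff_succAbove c).2 ⟨by simpa using hc, fun i => ?_⟩,
      fun i j k hij hjk hik hjk' => ?_⟩
    · simpa [F.mem_deleteCorner_iff hc] using hF i
    · rcases Fin.eq_self_or_eq_succAbove c k with rfl | ⟨k, rfl⟩
      · simp only [Fin.lt_def] at hij hjk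
        omega
      rcases Fin.eq_self_or_eq_succAbove c i with rfl | ⟨i, rfl⟩
      · exact absurd hik (by simpa using (Fin.castSucc_lt_last _).le)
      rcases Fin.eq_self_or_eq_succAbove c j with rfl | ⟨j, rfl⟩
      · exact absurd hjk' (by simpa using (Fin.castSucc_lt_last _).le)
      exact h i j k ((Fin.strictMono_succAbove c).lt_iff_lt.1 hij)
        ((Fin.strictMono_succAbove c).lt_iff_lt.1 hjk) (by simpa using hik) (by simpa using hjk')

theorem insertMax_avoidsLowerRightPair_iff {n : ℕ} (F : FerrersBoard (n + 1)) (c : Fin (n + 1))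
    (τ : Equiv.Perm (Fin n)) :
    FillingAvoidsLowerRightPair F (insertMax c τ) ↔
      ((c, Fin.last n) ∈ F.cells ∧ ∀ d, (d, Fin.last n) ∈ F.cells → d.val ≤ c.val + 1) ∧
        FillingAvoidsLowerRightPair F.deleteCorner τ := by
  constructor
  · rintro ⟨hF, h⟩
    have hc : (c, Fin.last n) ∈ F.cells := by simpa using hF c
    refine ⟨⟨hc, fun d hd => ?_⟩, fun i => ?_, fun i j k hij hjk hji hki hk => ?_⟩
    · by_contra! h1
      have lt_max : ∀ a, a ≠ c → insertMax c τ a < insertMax c τ c := fun a ha =>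
        lt_of_le_of_ne (by simpa using Fin.le_last _) ((insertMax c τ).injective.ne ha)
      refine h c ⟨c + 1, by omega⟩ d (by simp [Fin.lt_def]) (by simpa [Fin.lt_def])
        (lt_max _ ?_) (lt_max _ ?_) (by simpa) <;> simp only [ne_eq, Fin.ext_iff] <;> omega
    · simpa [F.mem_deleteCorner_iff hc] using hF (c.succAbove i)
    · exact h (c.succAbove i) (c.succAbove j) (c.succAbove k) (Fin.strictMono_succAbove c hij)
        (Fin.strictMono_succAbove c hjk) (by simpa) (by simpa)
        (by simpa [F.mem_deleteCorner_iff hc] using hk)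
  · rintro ⟨⟨hc, h1⟩, hF, h⟩
    refine ⟨(Fin.forall_iff_succAbove c).2 ⟨by simpa using hc, fun i => ?_⟩,
      fun i j k hij hjk hji hki hk => ?_⟩
    · simpa [F.mem_deleteCorner_iff hc] using hF i
    · rcases Fin.eq_self_or_eq_succAbove c i with rfl | ⟨i, rfl⟩
      · have := h1 k (by simpa using hk)
        simp only [Fin.lt_def] at hij hjk
        omega
      rcases Fin.eq_self_or_eq_succAbove c j with rfl | ⟨j, rfl⟩
      · exact absurd hji (by simpa using (Fin.castSucc_lt_last _).le)
      rcases Fin.eq_self_or_eq_succAbove c k with rfl | ⟨k, rfl⟩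
      · exact absurd hki (by simpa using (Fin.castSucc_lt_last _).le)
      exact h i j k ((Fin.strictMono_succAbove c).lt_iff_lt.1 hij)
        ((Fin.strictMono_succAbove c).lt_iff_lt.1 hjk) (by simpa using hji) (by simpa using hki)
        (by simpa [F.mem_deleteCorner_iff hc] using hk)

theorem card_perm_eq_mul_of_insertMax_iff {n : ℕ} {P : Equiv.Perm (Fin (n + 1)) → Prop}
    {Q : Fin (n + 1) → Prop} {R : Equiv.Perm (Fin n) → Prop}
    (h : ∀ c τ, P (insertMax c τ) ↔ Q c ∧ R τ) :
    Nat.card {σ // P σ} = Nat.card {c // Q c} * Nat.card {τ // R τ} := by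
  rw [← Nat.card_prod]
  exact Nat.card_congr <| Equiv.symm <| Equiv.subtypeProdEquivProd.symm.trans <|
    (Equiv.ofBijective _ (bijective_insertMax n)).subtypeEquiv fun p => (h p.1 p.2).symm

/-- A nonempty initial segment of `Fin n` has as many elements among its first two as among
its last two. -/
theorem card_first_two_eq_card_last_two {n : ℕ} (s : Set (Fin n)) (hs : IsLowerSet s) :
    Nat.card {c // c ∈ s ∧ c.val ≤ 1} =
      Nat.card {c // c ∈ s ∧ ∀ d ∈ s, d.val ≤ c.val + 1} := by
  rcases s.eq_empty_or_nonempty with rfl | hne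
  · simp
  obtain ⟨m, hm⟩ := s.toFinite.exists_maximal hne
  have le_m : ∀ d ∈ s, d.val ≤ m.val := fun d hd => by
    rcases le_total d m with h | h
    · exact h
    · exact hm.2 hd h
  have mem : ∀ d : Fin n, d.val ≤ m.val → d ∈ s := fun d hd => hs hd hm.1
  let rev : Fin n → Fin n := fun c => ⟨m - c, by omega⟩
  refine Nat.card_congr
    { toFun := fun c => ⟨rev c, mem _ (by simp [rev]), fun d hd => ?_⟩
      invFun := fun c => ⟨rev c, mem _ (by simp [rev]), ?_⟩
      left_inv := fun c => ?_
      right_inv := fun c => ?_ }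
  · have := le_m d hd
    have := c.2.2
    simp only [rev]
    omega
  · have := c.2.2 m hm.1
    simp only [rev]
    omega
  all_goals
    have := le_m c c.2.1
    ext
    simp only [rev]
    omega

theorem card_avoidsLowerLeftPair_eq_card_avoidsLowerRightPair {n : ℕ} (F : FerrersBoard n) :
    Nat.card {σ // FillingAvoidsLowerLeftPair F σ} =
      Nat.card {σ // FillingAvoidsLowerRightPair F σ} := by
  induction n with
  | zero => simp [FillingAvoidsLowerLeftPair, FillingAvoidsLowerRightPair]
  | succ n ih =>
    rw [card_perm_eq_mul_of_insertMax_iff (insertMax_avoidsLowerLeftPair_iff F),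
      card_perm_eq_mul_of_insertMax_iff (insertMax_avoidsLowerRightPair_iff F), ih]
    congr 1
    exact card_first_two_eq_card_last_two {c | (c, Fin.last n) ∈ F.cells}
      fun _ _ hba ha => F.downward_closed ha hba le_rfl

/-- The pattern sets {123, 213} and {312, 321} are shape-Wilf-equivalent. -/
theorem stmt10 : ShapeWilfEquiv {mkPattern ![0,1,2], mkPattern ![1,0,2]} {mkPattern ![2,0,1], mkPattern ![2,1,0]} := by
  intro n _ F
  simp only [filling_avoids_123_213_iff, filling_avoids_312_321_iff]
  exact card_avoidsLowerLeftPair_eq_card_avoidsLowerRightPair F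
end

section
/- The pattern sets {12453, 12543} and {21453, 21543} are shape-Wilf-equivalent. -/
/-- The cell `(i, j)` is shaded by `σ` when some occurrence of `231` or `321` of `σ` in the board
lies strictly to the right of column `i` and strictly above row `j`. -/
def Shaded {n : ℕ} (F : FerrersBoard n) (σ : Equiv.Perm (Fin n)) (i j : Fin n) : Prop :=
  ∃ a b c : Fin n, i < a ∧ a < b ∧ b < c ∧ j < σ c ∧ σ c < σ a ∧ σ c < σ b ∧
    (c, σ a) ∈ F.cells ∧ (c, σ b) ∈ F.cells

/-- No two rooks in increasing position span a rectangle of shaded cells. -/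
def AvoidsShadedAscents {n : ℕ} (F : FerrersBoard n) (σ : Equiv.Perm (Fin n)) : Prop :=
  ∀ k i : Fin n, k < i → σ k < σ i → ¬ Shaded F σ i (σ i)

/-- No two rooks in decreasing position span a rectangle of shaded cells. -/
def AvoidsShadedDescents {n : ℕ} (F : FerrersBoard n) (σ : Equiv.Perm (Fin n)) : Prop :=
  ∀ k i : Fin n, k < i → σ i < σ k → ¬ Shaded F σ i (σ k)

/-- `σ` and `τ` differ only by rooks placed in cells shaded by `σ`. -/
def AgreeOffShaded {n : ℕ} (F : FerrersBoard n) (σ τ : Equiv.Perm (Fin n)) : Prop :=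
  ∀ i : Fin n, (Shaded F σ i (σ i) ∧ Shaded F σ i (τ i)) ∨ σ i = τ i

section Shading

variable {n : ℕ} {F : FerrersBoard n} {σ τ ρ : Equiv.Perm (Fin n)}

theorem Shaded.mono {i j i' j' : Fin n} (h : Shaded F σ i j) (hi : i' ≤ i) (hj : j' ≤ j) :
    Shaded F σ i' j' := by
  obtain ⟨a, b, c, h1, h2, h3, h4, h5⟩ := h
  exact ⟨a, b, c, hi.trans_lt h1, h2, h3, hj.trans_lt h4, h5⟩

theorem Shaded.mem_cells {i j : Fin n} (h : Shaded F σ i j) : (i, j) ∈ F.cells := by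
  obtain ⟨a, b, c, h1, h2, h3, h4, h5, -, h7, -⟩ := h
  exact F.downward_closed h7 ((h1.trans h2).trans h3).le (h4.trans h5).le

theorem AgreeOffShaded.shaded_iff (h : AgreeOffShaded F σ τ) (i j : Fin n) :
    Shaded F τ i j ↔ Shaded F σ i j := by
  constructor
  · rintro ⟨a, b, c, h1, h2, h3, h4, h5, h6, h7, h8⟩
    by_contra hn
    have key : ∀ x, i < x → j < τ x → σ x = τ x := fun x hx hj =>
      (h x).resolve_left fun hs => hn (hs.2.mono hx.le hj.le)
    have ha := key a h1 (h4.trans h5)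
    have hb := key b (h1.trans h2) (h4.trans h6)
    have hc := key c ((h1.trans h2).trans h3) h4
    exact hn ⟨a, b, c, h1, h2, h3, by rwa [hc], by rwa [hc, ha], by rwa [hc, hb],
      by rwa [ha], by rwa [hb]⟩
  · intro hs
    obtain ⟨⟨i', j'⟩, hle, hmax⟩ :=
      (Set.toFinite {p : Fin n × Fin n | Shaded F σ p.1 p.2}).exists_le_maximal
        (show (i, j) ∈ _ from hs)
    obtain ⟨a, b, c, h1, h2, h3, h4, h5, h6, h7, h8⟩ := hmax.prop
    have key : ∀ x, i' < x → j' < σ x → σ x = τ x := fun x hx hj =>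
      (h x).resolve_left fun hs =>
        absurd (hmax.2 (y := (x, σ x)) hs.1 ⟨hx.le, hj.le⟩).1 (not_le.2 hx)
    have ha := key a h1 (h4.trans h5)
    have hb := key b (h1.trans h2) (h4.trans h6)
    have hc := key c ((h1.trans h2).trans h3) h4
    have hτ : Shaded F τ i' j' := ⟨a, b, c, h1, h2, h3, by rwa [← hc], by rwa [← hc, ← ha],
      by rwa [← hc, ← hb], by rwa [← ha], by rwa [← hb]⟩
    exact hτ.mono hle.1 hle.2

theorem AgreeOffShaded.refl (F : FerrersBoard n) (σ : Equiv.Perm (Fin n)) :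
    AgreeOffShaded F σ σ := fun _ => Or.inr rfl

theorem AgreeOffShaded.symm (h : AgreeOffShaded F σ τ) : AgreeOffShaded F τ σ := fun i => by
  simp only [h.shaded_iff]
  exact (h i).imp And.symm Eq.symm

theorem AgreeOffShaded.trans (h : AgreeOffShaded F σ τ) (h' : AgreeOffShaded F τ ρ) :
    AgreeOffShaded F σ ρ := fun i => by
  have h1 := h i
  have h2 := h' i
  simp only [h.shaded_iff] at h2
  grind

theorem AgreeOffShaded.isFilling (h : AgreeOffShaded F σ τ) (hσ : IsFilling F σ) :
    IsFilling F τ := fun i => by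
  rcases h i with hs | he
  · exact hs.2.mem_cells
  · exact he ▸ hσ i

theorem agreeOffShaded_mul_swap {i k : Fin n} (hi : Shaded F σ i (σ i)) (hk : Shaded F σ k (σ k))
    (hik : Shaded F σ i (σ k)) (hki : Shaded F σ k (σ i)) :
    AgreeOffShaded F σ (σ * Equiv.swap i k) := fun x => by
  rw [Equiv.Perm.mul_apply]
  by_cases hxi : x = i
  · subst hxi
    rw [Equiv.swap_apply_left]
    exact Or.inl ⟨hi, hik⟩
  by_cases hxk : x = k
  · subst hxk
    rw [Equiv.swap_apply_right]
    exact Or.inl ⟨hk, hki⟩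
  · rw [Equiv.swap_apply_of_ne_of_ne hxi hxk]
    exact Or.inr rfl

theorem sum_mul_swap_apply (σ : Equiv.Perm (Fin n)) {i k : Fin n} (hik : i ≠ k) :
    ∑ x : Fin n, (x : ℤ) * ((σ * Equiv.swap i k) x : ℤ) =
      ∑ x : Fin n, (x : ℤ) * (σ x : ℤ) + ((i : ℤ) - k) * ((σ k : ℤ) - σ i) := by
  rw [← sub_eq_iff_eq_add', ← Finset.sum_sub_distrib, Fintype.sum_eq_add i k hik]
  · simp only [Equiv.Perm.mul_apply, Equiv.swap_apply_left, Equiv.swap_apply_right]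
    ring
  · rintro x ⟨hxi, hxk⟩
    rw [Equiv.Perm.mul_apply, Equiv.swap_apply_of_ne_of_ne hxi hxk, sub_self]

theorem exists_agreeOffShaded_avoidsShadedDescents (F : FerrersBoard n) (σ : Equiv.Perm (Fin n)) :
    ∃ τ, AgreeOffShaded F σ τ ∧ AvoidsShadedDescents F τ := by
  obtain ⟨τ, hτ, hmax⟩ := Set.exists_max_image {τ | AgreeOffShaded F σ τ}
    (fun τ => ∑ x : Fin n, (x : ℤ) * (τ x : ℤ)) (Set.toFinite _) ⟨σ, .refl F σ⟩
  refine ⟨τ, hτ, fun k i hki hlt hs => ?_⟩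
  have hle := hmax _ (AgreeOffShaded.trans hτ (agreeOffShaded_mul_swap (hs.mono le_rfl hlt.le)
    (hs.mono hki.le le_rfl) hs (hs.mono hki.le hlt.le)))
  rw [sum_mul_swap_apply τ hki.ne'] at hle
  have h1 : (0 : ℤ) < (i : ℤ) - k := by rw [Fin.lt_def] at hki; omega
  have h2 : (0 : ℤ) < (τ k : ℤ) - τ i := by rw [Fin.lt_def] at hlt; omega
  linarith [mul_pos h1 h2]

theorem exists_agreeOffShaded_avoidsShadedAscents (F : FerrersBoard n) (σ : Equiv.Perm (Fin n)) :
    ∃ τ, AgreeOffShaded F σ τ ∧ AvoidsShadedAscents F τ := by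
  obtain ⟨τ, hτ, hmin⟩ := Set.exists_min_image {τ | AgreeOffShaded F σ τ}
    (fun τ => ∑ x : Fin n, (x : ℤ) * (τ x : ℤ)) (Set.toFinite _) ⟨σ, .refl F σ⟩
  refine ⟨τ, hτ, fun k i hki hlt hs => ?_⟩
  have hle := hmin _ (AgreeOffShaded.trans hτ (agreeOffShaded_mul_swap hs
    (hs.mono hki.le hlt.le) (hs.mono le_rfl hlt.le) (hs.mono hki.le le_rfl)))
  rw [sum_mul_swap_apply τ hki.ne'] at hle
  have h1 : (0 : ℤ) < (i : ℤ) - k := by rw [Fin.lt_def] at hki; omega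
  have h2 : (0 : ℤ) < (τ i : ℤ) - τ k := by rw [Fin.lt_def] at hlt; omega
  linarith [mul_pos h1 h2]

theorem exists_lt_apply_eq_of_agree_above {i : Fin n} (hne : σ i ≠ τ i)
    (h : ∀ x, i < x → σ x = τ x) : ∃ k < i, σ k = τ i := by
  refine ⟨σ.symm (τ i), ?_, σ.apply_symm_apply _⟩
  by_contra hlt
  rcases (not_lt.1 hlt).eq_or_lt with he | hgt
  · exact hne (by conv_lhs => rw [he, σ.apply_symm_apply])
  · have := h _ hgt
    rw [σ.apply_symm_apply] at this
    exact hgt.ne (τ.injective this)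

theorem exists_ne_agree_above (hne : σ ≠ τ) :
    ∃ i, σ i ≠ τ i ∧ ∀ x, i < x → σ x = τ x := by
  obtain ⟨y, hy⟩ : ∃ y, σ y ≠ τ y := by
    by_contra! h
    exact hne (Equiv.ext h)
  obtain ⟨i, hi, hmax⟩ := Set.exists_max_image {x | σ x ≠ τ x} id (Set.toFinite _) ⟨y, hy⟩
  exact ⟨i, hi, fun x hx => by_contra fun hn => absurd (hmax x hn) (not_le.2 hx)⟩

theorem AgreeOffShaded.eq_of_avoidsShadedDescents (h : AgreeOffShaded F σ τ)
    (hσ : AvoidsShadedDescents F σ) (hτ : AvoidsShadedDescents F τ) : σ = τ := by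
  by_contra hne
  obtain ⟨i, hi, habove⟩ := exists_ne_agree_above hne
  rcases lt_or_gt_of_ne hi with hlt | hlt
  · obtain ⟨k, hk, he⟩ := exists_lt_apply_eq_of_agree_above hi habove
    exact hσ k i hk (he ▸ hlt) (he ▸ ((h i).resolve_right hi).2)
  · obtain ⟨k, hk, he⟩ := exists_lt_apply_eq_of_agree_above hi.symm fun x hx => (habove x hx).symm
    exact hτ k i hk (he ▸ hlt) (he ▸ ((h.symm i).resolve_right hi.symm).2)

theorem AgreeOffShaded.eq_of_avoidsShadedAscents (h : AgreeOffShaded F σ τ)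
    (hσ : AvoidsShadedAscents F σ) (hτ : AvoidsShadedAscents F τ) : σ = τ := by
  by_contra hne
  obtain ⟨i, hi, habove⟩ := exists_ne_agree_above hne
  rcases lt_or_gt_of_ne hi with hlt | hlt
  · obtain ⟨k, hk, he⟩ := exists_lt_apply_eq_of_agree_above hi.symm fun x hx => (habove x hx).symm
    exact hτ k i hk (he ▸ hlt) ((h.symm i).resolve_right hi.symm).1
  · obtain ⟨k, hk, he⟩ := exists_lt_apply_eq_of_agree_above hi habove
    exact hσ k i hk (he ▸ hlt) ((h i).resolve_right hi).1

end Shading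

theorem Nat.card_subtype_le_of_forall_exists {α : Type*} [Finite α] {r : α → α → Prop}
    {P Q : α → Prop} (hex : ∀ x, P x → ∃ y, r x y ∧ Q y)
    (huniq : ∀ x x' y, P x → P x' → r x y → r x' y → x = x') :
    Nat.card {x // P x} ≤ Nat.card {x // Q x} := by
  choose f hr hQ using hex
  refine Nat.card_le_card_of_injective (fun x : {x // P x} => (⟨f x x.2, hQ x x.2⟩ : {x // Q x}))
    fun x x' hxx' => Subtype.ext (huniq x x' (f x x.2) x.2 x'.2 (hr x x.2) ?_)
  rw [Subtype.mk.inj hxx']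
  exact hr x' x'.2

theorem card_avoidsShadedAscents_eq_card_avoidsShadedDescents {n : ℕ} (F : FerrersBoard n) :
    Nat.card {σ : Equiv.Perm (Fin n) // IsFilling F σ ∧ AvoidsShadedAscents F σ} =
      Nat.card {σ : Equiv.Perm (Fin n) // IsFilling F σ ∧ AvoidsShadedDescents F σ} := by
  apply le_antisymm
  · refine Nat.card_subtype_le_of_forall_exists (r := AgreeOffShaded F) (fun σ hσ => ?_)
      fun σ σ' τ hσ hσ' h h' => (h.trans h'.symm).eq_of_avoidsShadedAscents hσ.2 hσ'.2
    obtain ⟨τ, h, hτ⟩ := exists_agreeOffShaded_avoidsShadedDescents F σ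
    exact ⟨τ, h, h.isFilling hσ.1, hτ⟩
  · refine Nat.card_subtype_le_of_forall_exists (r := AgreeOffShaded F) (fun σ hσ => ?_)
      fun σ σ' τ hσ hσ' h h' => (h.trans h'.symm).eq_of_avoidsShadedDescents hσ.2 hσ'.2
    obtain ⟨τ, h, hτ⟩ := exists_agreeOffShaded_avoidsShadedAscents F σ
    exact ⟨τ, h, h.isFilling hσ.1, hτ⟩

section Patterns

variable {n : ℕ} {F : FerrersBoard n} {σ : Equiv.Perm (Fin n)}

theorem fillingContains_mkPattern {k : ℕ} {v : Fin k → Fin k} {h : Function.Bijective v} :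
    FillingContains F σ (mkPattern v h) ↔ ∃ f : Fin k → Fin n, StrictMono f ∧
      (∀ a b, σ (f a) < σ (f b) ↔ v a < v b) ∧ ∀ a b, (f a, σ (f b)) ∈ F.cells :=
  Iff.rfl

theorem fillingContains_mkPattern_of_corner {v : Fin 5 → Fin 5} {h : Function.Bijective v}
    (f : Fin 5 → Fin n) (hf : StrictMono f) (m : Fin 5) (hm : ∀ b, v b ≤ v m)
    (hv : ∀ a b, v a < v b → σ (f a) < σ (f b)) (hF : (f 4, σ (f m)) ∈ F.cells) :
    FillingContains F σ (mkPattern v h) := by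
  have hle : ∀ a b, v a ≤ v b → σ (f a) ≤ σ (f b) := fun a b hab => by
    rcases hab.eq_or_lt with he | hlt
    · rw [h.1 he]
    · exact (hv a b hlt).le
  exact fillingContains_mkPattern.2 ⟨f, hf,
    fun a b => ⟨fun hab => not_le.1 fun hba => absurd hab (not_lt.2 (hle b a hba)), hv a b⟩,
    fun a b => F.downward_closed hF (hf.monotone (Fin.le_last a)) (hle b m (hm b))⟩

theorem strictMono_vec_five {a b c d e : Fin n} (h1 : a < b) (h2 : b < c) (h3 : c < d)
    (h4 : d < e) : StrictMono ![a, b, c, d, e] := by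
  rw [Fin.strictMono_iff_lt_succ]
  intro i
  fin_cases i <;> assumption

theorem fillingAvoidsSet_iff_avoidsShadedAscents :
    FillingAvoidsSet F σ {mkPattern ![0,1,3,4,2], mkPattern ![0,1,4,3,2]} ↔
      AvoidsShadedAscents F σ := by
  simp only [FillingAvoidsSet, Set.mem_insert_iff, Set.mem_singleton_iff, forall_eq_or_imp,
    forall_eq]
  constructor
  · rintro ⟨hp, hq⟩ k i hki hlt ⟨a, b, c, h1, h2, h3, h4, h5, h6, h7, h8⟩
    have hmono := strictMono_vec_five hki h1 h2 h3
    rcases lt_or_gt_of_ne (σ.injective.ne h2.ne) with hab | hab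
    · refine hp (fillingContains_mkPattern_of_corner _ hmono 3 (by decide) ?_ h8)
      simp [Fin.forall_fin_succ]
      grind
    · refine hq (fillingContains_mkPattern_of_corner _ hmono 2 (by decide) ?_ h7)
      simp [Fin.forall_fin_succ]
      grind
  · intro h
    constructor <;> rw [fillingContains_mkPattern] <;> rintro ⟨f, hf, hv, hF⟩ <;>
    exact h (f 0) (f 1) (hf (by decide)) ((hv _ _).2 (by decide)) ⟨f 2, f 3, f 4,
      hf (by decide), hf (by decide), hf (by decide), (hv _ _).2 (by decide),
      (hv _ _).2 (by decide), (hv _ _).2 (by decide), hF _ _, hF _ _⟩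

theorem fillingAvoidsSet_iff_avoidsShadedDescents :
    FillingAvoidsSet F σ {mkPattern ![1,0,3,4,2], mkPattern ![1,0,4,3,2]} ↔
      AvoidsShadedDescents F σ := by
  simp only [FillingAvoidsSet, Set.mem_insert_iff, Set.mem_singleton_iff, forall_eq_or_imp,
    forall_eq]
  constructor
  · rintro ⟨hp, hq⟩ k i hki hlt ⟨a, b, c, h1, h2, h3, h4, h5, h6, h7, h8⟩
    have hmono := strictMono_vec_five hki h1 h2 h3
    rcases lt_or_gt_of_ne (σ.injective.ne h2.ne) with hab | hab
    · refine hp (fillingContains_mkPattern_of_corner _ hmono 3 (by decide) ?_ h8)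
      simp [Fin.forall_fin_succ]
      grind
    · refine hq (fillingContains_mkPattern_of_corner _ hmono 2 (by decide) ?_ h7)
      simp [Fin.forall_fin_succ]
      grind
  · intro h
    constructor <;> rw [fillingContains_mkPattern] <;> rintro ⟨f, hf, hv, hF⟩ <;>
    exact h (f 0) (f 1) (hf (by decide)) ((hv _ _).2 (by decide)) ⟨f 2, f 3, f 4,
      hf (by decide), hf (by decide), hf (by decide), (hv _ _).2 (by decide),
      (hv _ _).2 (by decide), (hv _ _).2 (by decide), hF _ _, hF _ _⟩

end Patterns

/-- The pattern sets {12453, 12543} and {21453, 21543} are shape-Wilf-equivalent. -/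
theorem stmt13 : ShapeWilfEquiv {mkPattern ![0,1,3,4,2], mkPattern ![0,1,4,3,2]} {mkPattern ![1,0,3,4,2], mkPattern ![1,0,4,3,2]} := by
  intro n _ F
  simp only [fillingAvoidsSet_iff_avoidsShadedAscents, fillingAvoidsSet_iff_avoidsShadedDescents]
  exact card_avoidsShadedAscents_eq_card_avoidsShadedDescents F
end
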